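/- For every nonzero x ∈ C⁺(V) one has tr(x·λ·τ(x)·λ⁻¹) > 0; that is, the involution b ↦ λτ(b)λ⁻¹ of the opposite algebra B of C⁺(V) is a positive involution. -/

import Mathlib

open CliffordAlgebra

set_option synthInstance.maxHeartbeats 1000000
set_option maxHeartbeats 2000000

noncomputable section

variable (n : ℕ) (a : Fin (n + 2) → ℚ)

/-- The quadratic form `Q(x) = -a₁x₁² - a₂x₂² + a₃x₃² + ⋯ + a_{n+2}x_{n+2}²` on `V = ℚ^{n+2}`. -/
def Qf : QuadraticForm ℚ (Fin (n + 2) → ℚ) :=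
  QuadraticMap.weightedSumSquares ℚ (fun i => if (i : ℕ) < 2 then -a i else a i)

/-- The standard basis vectors `eᵢ` of `V`, viewed inside the Clifford algebra `C(V)`. -/
def e (i : Fin (n + 2)) : CliffordAlgebra (Qf n a) := ι (Qf n a) (Pi.single i 1)

/-- The even Clifford algebra `C⁺(V)`. -/
abbrev Cplus : Subalgebra ℚ (CliffordAlgebra (Qf n a)) := even (Qf n a)

/-- The reversal anti-automorphism `τ`, restricted to the even Clifford algebra. -/
def tau (x : Cplus n a) : Cplus n a :=
  ⟨reverse (Q := Qf n a) (x : CliffordAlgebra (Qf n a)), by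
    have hx : (x : CliffordAlgebra (Qf n a)) ∈ evenOdd (Qf n a) 0 := x.2
    exact (reverse_mem_evenOdd_iff (Q := Qf n a)).mpr hx⟩

/-- `tr z` is the trace of the ℚ-linear endomorphism `x ↦ z * x` of `C⁺(V)`. -/
def tr (z : Cplus n a) : ℚ := LinearMap.trace ℚ (Cplus n a) (LinearMap.mulLeft ℚ z)

/-- `λ := e₁e₂ ∈ C⁺(V)`. -/
def lam : Cplus n a := ⟨e n a 0 * e n a 1, ι_mul_ι_mem_evenOdd_zero (Qf n a) _ _⟩

/-- `λ⁻¹ = -(a₁a₂)⁻¹·λ`. -/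
def lamInv : Cplus n a := (-(a 0 * a 1)⁻¹) • lam n a


/-- The weights of the diagonal form. -/
def wt (i : Fin (n + 2)) : ℚ := if (i : ℕ) < 2 then -a i else a i

theorem Qf_apply (v : Fin (n + 2) → ℚ) : Qf n a v = ∑ i, wt n a i * (v i * v i) := by
  simp [Qf, QuadraticMap.weightedSumSquares_apply, wt]

theorem Qf_single (i : Fin (n + 2)) (c : ℚ) : Qf n a (Pi.single i c) = wt n a i * (c * c) := by
  rw [Qf_apply, Finset.sum_eq_single i]
  · simp
  · intro b _ hb
    simp [hb]
  · simp

theorem e_sq (i : Fin (n + 2)) :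
    e n a i * e n a i = algebraMap ℚ (CliffordAlgebra (Qf n a)) (wt n a i) := by
  rw [e, ι_sq_scalar, Qf_single]
  simp

theorem e_anti {i j : Fin (n + 2)} (h : i ≠ j) :
    e n a i * e n a j = -(e n a j * e n a i) := by
  apply ι_mul_ι_comm_of_isOrtho
  rw [QuadraticMap.isOrtho_def, Qf_single, Qf_single, Qf_apply, Finset.sum_eq_add i j h]
  · simp [h, h.symm]
  · intro c _ hc
    simp [hc.1, hc.2]
  · simp
  · simp

theorem ι_eq_sum (v : Fin (n + 2) → ℚ) : ι (Qf n a) v = ∑ i, v i • e n a i := by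
  conv_lhs => rw [← Finset.univ_sum_single v]
  rw [map_sum]
  refine Finset.sum_congr rfl fun i _ => ?_
  rw [e, ← map_smul]
  congr 1
  ext k
  by_cases hk : k = i
  · subst hk; simp
  · simp [hk]

/-- A factor of a monomial. -/
def fac (S : Finset (Fin (n + 2))) (i : Fin (n + 2)) : CliffordAlgebra (Qf n a) :=
  if i ∈ S then e n a i else 1

/-- The partial monomials. -/
def P (S : Finset (Fin (n + 2))) (L : List (Fin (n + 2))) : CliffordAlgebra (Qf n a) :=
  (L.map (fac n a S)).prod

theorem P_nil (S : Finset (Fin (n + 2))) : P n a S [] = 1 := by simp [P]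

theorem P_cons (S : Finset (Fin (n + 2))) (i : Fin (n + 2)) (L : List (Fin (n + 2))) :
    P n a S (i :: L) = fac n a S i * P n a S L := by simp [P]

/-- Toggle membership. -/
def tog (S : Finset (Fin (n + 2))) (j : Fin (n + 2)) : Finset (Fin (n + 2)) :=
  if j ∈ S then S.erase j else insert j S

theorem mem_tog_self (S : Finset (Fin (n + 2))) (j : Fin (n + 2)) :
    j ∈ tog n S j ↔ j ∉ S := by
  unfold tog; split_ifs with h <;> simp [h]

theorem mem_tog_ne (S : Finset (Fin (n + 2))) {i j : Fin (n + 2)} (h : i ≠ j) :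
    i ∈ tog n S j ↔ i ∈ S := by
  unfold tog; split_ifs <;> simp [h]

theorem P_tog (S : Finset (Fin (n + 2))) (j : Fin (n + 2)) (L : List (Fin (n + 2)))
    (hj : j ∉ L) : P n a (tog n S j) L = P n a S L := by
  unfold P
  congr 1
  apply List.map_congr_left
  intro i hi
  have : i ≠ j := fun h => hj (h ▸ hi)
  simp [fac, mem_tog_ne n S this]

theorem e_mul_P (S : Finset (Fin (n + 2))) (j : Fin (n + 2)) (L : List (Fin (n + 2)))
    (hL : L.Nodup) (hj : j ∈ L) :
    ∃ c : ℚ, e n a j * P n a S L = c • P n a (tog n S j) L := by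
  induction L with
  | nil => simp at hj
  | cons i t ih =>
    rw [List.nodup_cons] at hL
    simp only [P_cons]
    by_cases hij : i = j
    · subst hij
      rw [P_tog n a S i t hL.1]
      by_cases hS : i ∈ S
      · refine ⟨wt n a i, ?_⟩
        simp only [fac, mem_tog_self, hS, not_true_eq_false, if_true, if_false, one_mul]
        rw [← mul_assoc, e_sq, Algebra.smul_def]
      · refine ⟨1, ?_⟩
        simp [fac, mem_tog_self, hS]
    · have hjt : j ∈ t := by
        rcases List.mem_cons.1 hj with h | h
        · exact absurd h.symm hij
        · exact h
      obtain ⟨c, hc⟩ := ih hL.2 hjt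
      by_cases hS : i ∈ S
      · refine ⟨-c, ?_⟩
        simp only [fac, mem_tog_ne n S hij, hS, if_true]
        rw [← mul_assoc, e_anti n a (Ne.symm hij), neg_mul, mul_assoc, hc, mul_smul_comm, neg_smul]
      · refine ⟨c, ?_⟩
        simp only [fac, mem_tog_ne n S hij, hS, if_false, one_mul]
        exact hc

theorem P_mul_reverse (S : Finset (Fin (n + 2))) (L : List (Fin (n + 2))) :
    P n a S L * reverse (P n a S L) =
      algebraMap ℚ _ ((L.map fun i => if i ∈ S then wt n a i else 1).prod) := by
  induction L with
  | nil => simp [P_nil]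
  | cons i t ih =>
    rw [P_cons, reverse.map_mul, mul_assoc, ← mul_assoc (P n a S t), ih, List.map_cons,
      List.prod_cons, map_mul, Algebra.commutes, ← mul_assoc]
    congr 1
    by_cases hS : i ∈ S
    · simp only [fac, hS, if_true]
      rw [show reverse (e n a i) = e n a i from reverse_ι _, e_sq]
    · simp [fac, hS]

/-- The sign of a basis vector under conjugation by `λ`. -/
def sg (i : Fin (n + 2)) : ℚ := if (i : ℕ) < 2 then -1 else 1

theorem lam_mul_e (i : Fin (n + 2)) :
    e n a 0 * e n a 1 * e n a i = sg n i • (e n a i * (e n a 0 * e n a 1)) := by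
  have h01 : (0 : Fin (n + 2)) ≠ 1 := by simp
  by_cases h0 : i = 0
  · subst h0
    simp only [sg, Fin.val_zero, Nat.zero_lt_two, if_true]
    rw [mul_assoc, e_anti n a h01.symm]
    simp
  by_cases h1 : i = 1
  · subst h1
    have : ((1 : Fin (n + 2)) : ℕ) < 2 := by simp
    simp only [sg, this, if_true]
    rw [← mul_assoc (e n a 1), e_anti n a h01.symm]
    simp
  · have : ¬ (i : ℕ) < 2 := by
      intro h
      have hz0 : (i : ℕ) ≠ 0 := fun h => h0 (Fin.ext h)
      have hz1 : (i : ℕ) ≠ 1 := fun h => h1 (Fin.ext (by simpa using h))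
      omega
    simp only [sg, this, if_false, one_smul]
    rw [mul_assoc, e_anti n a (Ne.symm h1), mul_neg, ← mul_assoc, e_anti n a (Ne.symm h0)]
    simp [mul_assoc]

theorem lam_mul_reverse (S : Finset (Fin (n + 2))) (L : List (Fin (n + 2))) :
    e n a 0 * e n a 1 * reverse (P n a S L) =
      ((L.map fun i => if i ∈ S then sg n i else 1).prod) •
        (reverse (P n a S L) * (e n a 0 * e n a 1)) := by
  induction L with
  | nil => simp [P_nil]
  | cons i t ih =>
    rw [P_cons, reverse.map_mul, ← mul_assoc, ih, List.map_cons, List.prod_cons, smul_mul_assoc,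
      mul_comm, mul_smul, mul_assoc (reverse (P n a S t)), mul_assoc (reverse (P n a S t))]
    congr 1
    by_cases hS : i ∈ S
    · simp only [fac, hS, if_true]
      rw [show reverse (e n a i) = e n a i from reverse_ι _, lam_mul_e, mul_smul_comm]
    · simp [fac, hS]

/-- The reflection in the `i`-th coordinate, as a linear map. -/
def rfln (i : Fin (n + 2)) : (Fin (n + 2) → ℚ) →ₗ[ℚ] (Fin (n + 2) → ℚ) :=
  LinearMap.pi fun k => (if k = i then (-1 : ℚ) else 1) • LinearMap.proj k

theorem rfln_single (i j : Fin (n + 2)) :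
    rfln n i (Pi.single j 1) = (if j = i then (-1 : ℚ) else 1) • Pi.single j 1 := by
  ext k
  by_cases hk : k = j
  · subst hk; by_cases hi : k = i <;> simp [rfln, hi]
  · by_cases hi : k = i
    · simp [rfln, hi, hi ▸ hk]
    · simp [rfln, hi, hk]

/-- The automorphism of the Clifford algebra negating `eᵢ`. -/
def phi (i : Fin (n + 2)) : CliffordAlgebra (Qf n a) →ₐ[ℚ] CliffordAlgebra (Qf n a) :=
  CliffordAlgebra.lift (Qf n a) ⟨ι (Qf n a) ∘ₗ rfln n i, fun m => by
    rw [LinearMap.comp_apply, ι_sq_scalar]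
    congr 1
    rw [Qf_apply, Qf_apply]
    refine Finset.sum_congr rfl fun k _ => ?_
    by_cases hk : k = i <;> simp [rfln, hk]⟩

theorem phi_ι (i : Fin (n + 2)) (v : Fin (n + 2) → ℚ) :
    phi n a i (ι (Qf n a) v) = ι (Qf n a) (rfln n i v) := by
  simp [phi]

theorem phi_e (i j : Fin (n + 2)) :
    phi n a i (e n a j) = (if j = i then (-1 : ℚ) else 1) • e n a j := by
  rw [e, phi_ι, rfln_single, map_smul]

theorem phi_phi (i : Fin (n + 2)) (x : CliffordAlgebra (Qf n a)) :
    phi n a i (phi n a i x) = x := by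
  have : (phi n a i).comp (phi n a i) = AlgHom.id ℚ _ := by
    ext v
    simp only [AlgHom.toLinearMap_apply, LinearMap.comp_apply, AlgHom.comp_apply, phi_ι]
    rw [AlgHom.id_apply]
    congr 1
    ext k
    by_cases hk : k = i <;> simp [rfln, hk]
  exact DFunLike.congr_fun this x

theorem phi_even (i : Fin (n + 2)) (x : CliffordAlgebra (Qf n a)) (hx : x ∈ Cplus n a) :
    phi n a i x ∈ Cplus n a := by
  induction x, hx using even_induction with
  | algebraMap r => rw [AlgHom.commutes]; exact Subalgebra.algebraMap_mem _ _
  | add x y hx hy h1 h2 => rw [map_add]; exact add_mem h1 h2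
  | ι_mul_ι_mul v w x hx h =>
    rw [map_mul, map_mul, phi_ι, phi_ι]
    exact mul_mem (ι_mul_ι_mem_evenOdd_zero (Qf n a) _ _) h

theorem phi_P (i : Fin (n + 2)) (S : Finset (Fin (n + 2))) (L : List (Fin (n + 2)))
    (hL : L.Nodup) :
    phi n a i (P n a S L) = (if i ∈ S ∧ i ∈ L then (-1 : ℚ) else 1) • P n a S L ∧
    phi n a i (reverse (P n a S L)) =
      (if i ∈ S ∧ i ∈ L then (-1 : ℚ) else 1) • reverse (P n a S L) := by
  induction L with
  | nil => simp [P_nil]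
  | cons j t ih =>
    rw [List.nodup_cons] at hL
    obtain ⟨h1, h2⟩ := ih hL.2
    rw [P_cons, reverse.map_mul, map_mul, map_mul, h1, h2]
    by_cases hjS : j ∈ S
    · simp only [fac, hjS, if_true]
      rw [show reverse (e n a j) = e n a j from reverse_ι _, phi_e]
      by_cases hji : j = i
      · subst hji
        simp [hjS, hL.1]
      · simp [hji, Ne.symm hji]
    · have : i ∈ S → i ≠ j := fun h hh => hjS (hh ▸ h)
      have h3 : (i ∈ S ∧ i ∈ j :: t) ↔ (i ∈ S ∧ i ∈ t) := by
        constructor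
        · rintro ⟨h, hh⟩
          exact ⟨h, (List.mem_cons.1 hh).resolve_left (this h)⟩
        · rintro ⟨h, hh⟩
          exact ⟨h, List.mem_cons_of_mem _ hh⟩
      simp only [h3]
      simp [fac, hjS]

/-- The monomials `e_S`. -/
def E (S : Finset (Fin (n + 2))) : CliffordAlgebra (Qf n a) := P n a S (List.finRange (n + 2))

theorem e_mul_E (S : Finset (Fin (n + 2))) (j : Fin (n + 2)) :
    ∃ c : ℚ, ∃ T, e n a j * E n a S = c • E n a T := by
  obtain ⟨c, hc⟩ := e_mul_P n a S j (List.finRange (n + 2)) (List.nodup_finRange _)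
    (List.mem_finRange _)
  exact ⟨c, _, hc⟩

/-- Index type of even monomials. -/
abbrev Idx := {S : Finset (Fin (n + 2)) // E n a S ∈ Cplus n a}

instance : Fintype (Idx n a) := Fintype.ofFinite _

/-- Even monomials. -/
def b (S : Idx n a) : Cplus n a := ⟨E n a S.1, S.2⟩

theorem E_empty : E n a ∅ = 1 := by
  have : ∀ L, P n a ∅ L = 1 := by
    intro L
    induction L with
    | nil => simp [P_nil]
    | cons i t ih => simp [P_cons, ih, fac]
  exact this _

theorem span_even (x : CliffordAlgebra (Qf n a)) (hx : x ∈ Cplus n a) :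
    x ∈ Submodule.span ℚ (Set.range fun S : Idx n a => E n a S.1) := by
  induction x, hx using even_induction with
  | algebraMap r =>
    rw [Algebra.algebraMap_eq_smul_one]
    refine Submodule.smul_mem _ _ (Submodule.subset_span ⟨⟨∅, ?_⟩, E_empty n a⟩)
    rw [E_empty]
    exact one_mem _
  | add x y hx hy h1 h2 => exact add_mem h1 h2
  | ι_mul_ι_mul v w x hx h =>
    clear hx
    induction h using Submodule.span_induction with
    | zero => rw [mul_zero]; exact zero_mem _
    | add x y _ _ h1 h2 => rw [mul_add]; exact add_mem h1 h2
    | smul c x _ h => rw [mul_smul_comm]; exact Submodule.smul_mem _ _ h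
    | mem x h =>
      obtain ⟨⟨S, hS⟩, rfl⟩ := h
      dsimp only
      rw [ι_eq_sum n a v, ι_eq_sum n a w, Finset.sum_mul_sum, Finset.sum_mul]
      refine sum_mem fun i _ => ?_
      rw [Finset.sum_mul]
      refine sum_mem fun j _ => ?_
      rw [smul_mul_smul_comm, smul_mul_assoc]
      refine Submodule.smul_mem _ _ ?_
      have hmem : e n a i * e n a j * E n a S ∈ Cplus n a :=
        mul_mem (ι_mul_ι_mem_evenOdd_zero (Qf n a) _ _) hS
      obtain ⟨c, T, hc⟩ := e_mul_E n a S j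
      obtain ⟨d, U, hd⟩ := e_mul_E n a T i
      have key : e n a i * e n a j * E n a S = (c * d) • E n a U := by
        rw [mul_assoc, hc, mul_smul_comm, hd, smul_smul]
      rw [key] at hmem ⊢
      by_cases h0 : c * d = 0
      · rw [h0, zero_smul]; exact zero_mem _
      · refine Submodule.smul_mem _ _ (Submodule.subset_span ⟨⟨U, ?_⟩, rfl⟩)
        have := Subalgebra.smul_mem _ hmem (c * d)⁻¹
        rwa [smul_smul, inv_mul_cancel₀ h0, one_smul] at this

theorem span_b : Submodule.span ℚ (Set.range (b n a)) = ⊤ := by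
  rw [eq_top_iff]
  rintro ⟨x, hx⟩ -
  obtain ⟨c, hc⟩ := (Submodule.mem_span_range_iff_exists_fun ℚ).1 (span_even n a x hx)
  refine (Submodule.mem_span_range_iff_exists_fun ℚ).2 ⟨c, Subtype.ext ?_⟩
  refine Eq.trans ?_ hc
  simp [b]

theorem fin_Cplus : Module.Finite ℚ (Cplus n a) :=
  ⟨⟨(Set.finite_range (b n a)).toFinset, by rw [Set.Finite.coe_toFinset, span_b]⟩⟩

/-- The automorphism `phi` restricted to the even part. -/
def phiE (i : Fin (n + 2)) : Cplus n a →ₗ[ℚ] Cplus n a where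
  toFun x := ⟨phi n a i x, phi_even n a i _ x.2⟩
  map_add' x y := Subtype.ext (by simp)
  map_smul' c x := Subtype.ext (by simp)

/-- `tr` as a linear map. -/
def trL : Cplus n a →ₗ[ℚ] ℚ := LinearMap.trace ℚ (Cplus n a) ∘ₗ LinearMap.mul ℚ (Cplus n a)

theorem tr_eq (z : Cplus n a) : tr n a z = trL n a z := rfl

theorem tr_zero_of_phi (i : Fin (n + 2)) (z : Cplus n a) (hz : phi n a i z = -z) :
    tr n a z = 0 := by
  have := fin_Cplus n a
  have h1 : phiE n a i ∘ₗ (LinearMap.mulLeft ℚ z ∘ₗ phiE n a i) = - LinearMap.mulLeft ℚ z := by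
    ext x
    simp [phiE, hz, phi_phi]
  have h2 : (LinearMap.mulLeft ℚ z ∘ₗ phiE n a i) ∘ₗ phiE n a i = LinearMap.mulLeft ℚ z := by
    ext x
    simp [phiE, phi_phi]
  have h3 := LinearMap.trace_comp_comm' (phiE n a i) (LinearMap.mulLeft ℚ z ∘ₗ phiE n a i)
  rw [h1, h2, map_neg] at h3
  unfold tr
  linarith

theorem tr_one_pos : 0 < tr n a 1 := by
  have := fin_Cplus n a
  rw [tr, LinearMap.mulLeft_one, LinearMap.trace_id]
  exact_mod_cast Module.finrank_pos

theorem lam_lamInv (ha : ∀ i, 0 < a i) : lam n a * lamInv n a = 1 := by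
  have h01 : (0 : Fin (n + 2)) ≠ 1 := by simp
  apply Subtype.ext
  have h : (e n a 0 * e n a 1) * (e n a 0 * e n a 1) = algebraMap ℚ _ (-(a 0 * a 1)) := by
    rw [mul_assoc, ← mul_assoc (e n a 1), e_anti n a h01.symm, neg_mul, mul_assoc, e_sq, mul_neg,
      ← mul_assoc, e_sq, ← map_mul, ← map_neg]
    simp [wt]
  simp only [lam, lamInv, MulMemClass.coe_mul, SetLike.val_smul, mul_smul_comm, h, OneMemClass.coe_one]
  rw [Algebra.algebraMap_eq_smul_one, smul_smul]
  have := (ha 0).ne'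
  have := (ha 1).ne'
  rw [show -(a 0 * a 1)⁻¹ * -(a 0 * a 1) = 1 by field_simp, one_smul]

/-- The sign attached to a monomial. -/
def sgn (S : Finset (Fin (n + 2))) : ℚ :=
  ((List.finRange (n + 2)).map fun i => if i ∈ S then sg n i else 1).prod

/-- The norm of a monomial. -/
def nrm (S : Finset (Fin (n + 2))) : ℚ :=
  ((List.finRange (n + 2)).map fun i => if i ∈ S then wt n a i else 1).prod

theorem sgn_mul_nrm_pos (ha : ∀ i, 0 < a i) (S : Finset (Fin (n + 2))) :
    0 < sgn n S * nrm n a S := by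
  unfold sgn nrm
  generalize List.finRange (n + 2) = L
  induction L with
  | nil => simp
  | cons i t ih =>
    simp only [List.map_cons, List.prod_cons]
    rw [mul_mul_mul_comm]
    refine mul_pos ?_ ih
    have := ha i
    by_cases hS : i ∈ S <;> by_cases h2 : (i : ℕ) < 2 <;> simp [hS, h2, sg, wt, this]

theorem sigma_b (ha : ∀ i, 0 < a i) (T : Idx n a) :
    lam n a * tau n a (b n a T) * lamInv n a = sgn n T.1 • tau n a (b n a T) := by
  have h : lam n a * tau n a (b n a T) = sgn n T.1 • (tau n a (b n a T) * lam n a) :=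
    Subtype.ext (lam_mul_reverse n a T.1 _)
  rw [h, smul_mul_assoc, mul_assoc, lam_lamInv n a ha, mul_one]

theorem tr_b (ha : ∀ i, 0 < a i) (S T : Idx n a) :
    tr n a (b n a S * (lam n a * tau n a (b n a T) * lamInv n a)) =
      if S = T then sgn n S.1 * nrm n a S.1 * tr n a 1 else 0 := by
  rw [sigma_b n a ha, mul_smul_comm, tr_eq, map_smul, ← tr_eq, smul_eq_mul]
  split_ifs with h
  · subst h
    have : b n a S * tau n a (b n a S) = nrm n a S.1 • 1 := by
      apply Subtype.ext
      refine (P_mul_reverse n a S.1 _).trans ?_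
      rw [Algebra.algebraMap_eq_smul_one]
      rfl
    rw [this, tr_eq, map_smul, ← tr_eq, smul_eq_mul, mul_assoc]
  · have : ∃ i, ¬ (i ∈ S.1 ↔ i ∈ T.1) := by
      by_contra hcon
      push Not at hcon
      exact h (Subtype.ext (Finset.ext hcon))
    obtain ⟨i, hi⟩ := this
    rw [tr_zero_of_phi n a i, mul_zero]
    have h1 := (phi_P n a i S.1 _ (List.nodup_finRange (n + 2))).1
    have h2 := (phi_P n a i T.1 _ (List.nodup_finRange (n + 2))).2
    change phi n a i (P n a S.1 (List.finRange (n + 2)) * reverse (P n a T.1 (List.finRange (n + 2))))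
      = -(P n a S.1 (List.finRange (n + 2)) * reverse (P n a T.1 (List.finRange (n + 2))))
    rw [map_mul, h1, h2]
    by_cases hS : i ∈ S.1 <;> by_cases hT : i ∈ T.1 <;> simp_all

/-- `tau` as a linear map. -/
def tauL : Cplus n a →ₗ[ℚ] Cplus n a where
  toFun := tau n a
  map_add' x y := Subtype.ext (by simp [tau])
  map_smul' c x := Subtype.ext (by simp [tau])

/-- For every nonzero `x ∈ C⁺(V)` one has `tr(x·λ·τ(x)·λ⁻¹) > 0`; that is, the involution
`b ↦ λτ(b)λ⁻¹` of the opposite algebra `B` of `C⁺(V)` is a positive involution. -/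
theorem statement1 (hn : 1 ≤ n) (ha : ∀ i, 0 < a i) :
    ∀ x : Cplus n a, x ≠ 0 →
      0 < tr n a (x * lam n a * tau n a x * lamInv n a) := by
  intro x hx
  obtain ⟨c, hc⟩ := (Submodule.mem_span_range_iff_exists_fun ℚ).1
    (show x ∈ Submodule.span ℚ (Set.range (b n a)) by rw [span_b]; trivial)
  have htau : tau n a x = ∑ T, c T • tau n a (b n a T) := by
    change tauL n a x = ∑ T, c T • tauL n a (b n a T)
    rw [← hc, map_sum]
    simp only [map_smul]
  have key : tr n a (x * lam n a * tau n a x * lamInv n a) =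
      ∑ S, c S * c S * (sgn n S.1 * nrm n a S.1 * tr n a 1) := by
    have h1 : x * lam n a * tau n a x * lamInv n a =
        ∑ S, ∑ T, (c S * c T) • (b n a S * (lam n a * tau n a (b n a T) * lamInv n a)) := by
      rw [htau, mul_assoc, mul_assoc, ← mul_assoc (lam n a), Finset.mul_sum, Finset.sum_mul]
      conv_lhs => rw [← hc]
      rw [Finset.sum_mul_sum]
      refine Finset.sum_congr rfl fun S _ => Finset.sum_congr rfl fun T _ => ?_
      rw [mul_smul_comm, smul_mul_assoc, smul_mul_assoc, mul_smul_comm, smul_smul]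
    rw [h1, tr_eq, map_sum]
    refine Finset.sum_congr rfl fun S _ => ?_
    rw [map_sum, Finset.sum_eq_single S]
    · rw [map_smul, ← tr_eq, tr_b n a ha, if_pos rfl, smul_eq_mul]
    · intro T _ hT
      rw [map_smul, ← tr_eq, tr_b n a ha, if_neg (Ne.symm hT), smul_zero]
    · simp
  rw [key]
  have hpos : ∀ S : Idx n a, 0 < sgn n S.1 * nrm n a S.1 * tr n a 1 := fun S =>
    mul_pos (sgn_mul_nrm_pos n a ha S.1) (tr_one_pos n a)
  have hex : ∃ S, c S ≠ 0 := by
    by_contra hcon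
    push Not at hcon
    apply hx
    rw [← hc]
    simp [hcon]
  obtain ⟨S, hS⟩ := hex
  refine Finset.sum_pos' (fun T _ => mul_nonneg (mul_self_nonneg _) (hpos T).le)
    ⟨S, Finset.mem_univ _, mul_pos (mul_self_pos.2 hS) (hpos S)⟩
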